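/- Let H ∈ (1/2,1), T > 0 and α < 1/(2H) − 3/2. Then the series ∑_{n=1}^∞ (n+2)^α · n · n! · c_n² · ∫_0^T ∫_0^T R(u,v)^{n−1} u^{−Hn} v^{−Hn} du dv converges (is finite). (This is the off-diagonal part B(n) of the Sobolev–Watanabe norm computation showing that the fractional Brownian current ξ(x) belongs to 𝔻^{−α',2} for every α' > 3/2 − 1/(2H).) -/

import Mathlib

open MeasureTheory Real

/-- The covariance function of fractional Brownian motion with Hurst parameter `H`:
`R(t,s) = (1/2)(t^{2H}+s^{2H}−|t−s|^{2H})`. -/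
noncomputable def fbmCov (H t s : ℝ) : ℝ :=
  (t ^ (2 * H) + s ^ (2 * H) - |t - s| ^ (2 * H)) / 2

/-- The constant `c_n = 2^{n/2} Γ((n+1)/2) / (√π · n!)`. -/
noncomputable def hermiteBound (n : ℕ) : ℝ :=
  2 ^ ((n : ℝ) / 2) * Real.Gamma (((n : ℝ) + 1) / 2) / (Real.sqrt Real.pi * n.factorial)

theorem fbmCov_comm (H s t : ℝ) : fbmCov H s t = fbmCov H t s := by
  simp only [fbmCov, abs_sub_comm s t]
  ring

theorem fbmCov_mul_left {H u z : ℝ} (hu : 0 < u) (hz : 0 < z) :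
    fbmCov H u (u * z) = u ^ (2 * H) * fbmCov H 1 z := by
  have h : |u - u * z| = u * |1 - z| := by
    rw [← abs_of_pos hu, ← abs_mul, abs_of_pos hu, mul_one_sub]
  rw [fbmCov, fbmCov, h, Real.mul_rpow hu.le hz.le, Real.mul_rpow hu.le (abs_nonneg _),
    Real.one_rpow]
  ring

/-- The correlation coefficient `R(1,z) / z ^ H` is nonnegative. -/
theorem fbmCov_one_div_rpow_nonneg {H z : ℝ} (hH : 0 < H) (hz : 0 < z) (hz1 : z < 1) :
    0 ≤ fbmCov H 1 z / z ^ H := by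
  have h : |1 - z| ^ (2 * H) ≤ 1 :=
    Real.rpow_le_one (abs_nonneg _) (by rw [abs_le]; constructor <;> linarith) (by linarith)
  have h2 : 0 ≤ z ^ (2 * H) := by positivity
  have : 0 ≤ fbmCov H 1 z := by
    rw [fbmCov, Real.one_rpow]
    linarith
  positivity

theorem fbmCov_one_div_rpow_le {H z : ℝ} (hH : 1 / 2 < H) (hH1 : H < 1) (hz : 0 < z)
    (hz1 : z < 1) :
    fbmCov H 1 z / z ^ H ≤ 1 - (1 - H) * (z ^ (1 - H) * (1 - z) ^ (2 * H)) := by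
  have h1z : 0 < 1 - z := by linarith
  have hzH : 0 < z ^ H := by positivity
  have hmono : z ≤ z ^ H := by
    simpa using Real.rpow_le_rpow_of_exponent_ge hz hz1.le hH1.le
  have hle1 : z ^ H ≤ 1 := Real.rpow_le_one hz.le hz1.le (by linarith)
  have hbern : (1 - z) ^ (2 - 2 * H) ≤ 1 - (2 - 2 * H) * z := by
    have := rpow_one_add_le_one_add_mul_self (s := -z) (by linarith)
      (p := 2 - 2 * H) (by linarith) (by linarith)
    rw [← sub_eq_add_neg] at this
    linarith
  have hsplit : (1 - z) ^ 2 = (1 - z) ^ (2 * H) * (1 - z) ^ (2 - 2 * H) := by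
    rw [← Real.rpow_add h1z, ← Real.rpow_natCast]
    congr 1
    push_cast
    ring
  have hz2 : z ^ (2 * H) = z ^ H * z ^ H := by
    rw [← Real.rpow_add hz]
    ring_nf
  have hzz : z ^ H * z ^ (1 - H) = z := by
    rw [← Real.rpow_add hz]
    simp
  have hw : 0 < (1 - z) ^ (2 * H) := by positivity
  have hprod := mul_le_mul_of_nonneg_left hbern hw.le
  have hsq : (1 - z ^ H) ^ 2 ≤ (1 - z) ^ 2 := by
    apply pow_le_pow_left₀ <;> linarith
  rw [div_le_iff₀ hzH, fbmCov, Real.one_rpow, abs_of_pos h1z, hz2]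
  have hexp : (1 - (1 - H) * (z ^ (1 - H) * (1 - z) ^ (2 * H))) * z ^ H
      = z ^ H - (1 - H) * (1 - z) ^ (2 * H) * z := by
    linear_combination (-(1 - H) * (1 - z) ^ (2 * H)) * hzz
  rw [hexp]
  nlinarith

/-- A polynomial decay estimate for powers of a number close to `1`. -/
theorem pow_le_rpow_neg_mul_rpow_neg {x y γ : ℝ} (k : ℕ) (hx : 0 ≤ x) (hy : 0 < y)
    (hxy : x ≤ 1 - y) (hγ : 0 < γ) (hγ1 : γ ≤ 1) :
    x ^ k ≤ Real.exp 1 * ((k : ℝ) + 1) ^ (-γ) * y ^ (-γ) := by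
  have hk : 0 < (k : ℝ) + 1 := by positivity
  have hpow : x ^ k ≤ Real.exp 1 * Real.exp (-((k + 1) * y)) := by
    calc x ^ k ≤ Real.exp (-y) ^ k := by
          apply pow_le_pow_left₀ hx
          linarith [Real.add_one_le_exp (-y)]
      _ = Real.exp (y - (k + 1) * y) := by
          rw [← Real.exp_nat_mul]
          ring_nf
      _ ≤ Real.exp (1 - (k + 1) * y) := by
          apply Real.exp_le_exp.2
          linarith
      _ = _ := by rw [← Real.exp_add]; ring_nf
  have hexp : Real.exp (-((k + 1) * y)) ≤ (((k : ℝ) + 1) * y) ^ (-γ) := by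
    have hw : 0 < ((k : ℝ) + 1) * y := by positivity
    rw [Real.exp_neg, Real.rpow_neg hw.le]
    apply inv_anti₀ (by positivity)
    have h1 := Real.add_one_le_exp (((k : ℝ) + 1) * y)
    rcases le_total (((k : ℝ) + 1) * y) 1 with h | h
    · exact (Real.rpow_le_one hw.le h hγ.le).trans (by linarith)
    · have := Real.rpow_le_rpow_of_exponent_le h hγ1
      rw [Real.rpow_one] at this
      linarith
  rw [Real.mul_rpow hk.le hy.le] at hexp
  calc x ^ k ≤ _ := hpow
    _ ≤ Real.exp 1 * (((k : ℝ) + 1) ^ (-γ) * y ^ (-γ)) := by gcongr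
    _ = _ := by ring

/-- The integrand of the Beta integral, in terms of the orders of its two singularities. -/
noncomputable def betaKernel (a b z : ℝ) : ℝ := z ^ (-a) * (1 - z) ^ (-b)

theorem betaKernel_nonneg {a b z : ℝ} (hz : 0 ≤ z) (hz1 : z ≤ 1) : 0 ≤ betaKernel a b z :=
  mul_nonneg (Real.rpow_nonneg hz _) (Real.rpow_nonneg (by linarith) _)

theorem measurable_betaKernel (a b : ℝ) : Measurable (betaKernel a b) := by
  unfold betaKernel
  fun_prop

theorem intervalIntegrable_betaKernel {a b : ℝ} (ha : a < 1) (hb : b < 1) :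
    IntervalIntegrable (betaKernel a b) volume 0 1 := by
  have h := (Complex.betaIntegral_convergent (u := ((1 - a : ℝ) : ℂ)) (v := ((1 - b : ℝ) : ℂ))
    (by simpa using ha) (by simpa using hb)).norm
  rw [intervalIntegrable_iff_integrableOn_Ioo_of_le zero_le_one] at h ⊢
  refine h.congr_fun (fun x hx => ?_) measurableSet_Ioo
  have h1 : 0 < 1 - x := by linarith [hx.2]
  have e : (1 : ℂ) - (x : ℂ) = ((1 - x : ℝ) : ℂ) := by push_cast; ring
  simp only [betaKernel]
  rw [e, norm_mul, Complex.norm_cpow_eq_rpow_re_of_pos hx.1,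
    Complex.norm_cpow_eq_rpow_re_of_pos h1]
  simp

theorem fbmCov_integrand_mul_left {H u z : ℝ} (k : ℕ) (hu : 0 < u) (hz : 0 < z) :
    fbmCov H u (u * z) ^ k * u ^ (-(H * (k + 1 : ℕ))) * (u * z) ^ (-(H * (k + 1 : ℕ))) =
      u ^ (-(2 * H)) * z ^ (-H) * (fbmCov H 1 z / z ^ H) ^ k := by
  rw [fbmCov_mul_left hu hz, Real.mul_rpow hu.le hz.le, mul_pow, div_pow,
    ← Real.rpow_mul_natCast hu.le, ← Real.rpow_mul_natCast hz.le, div_eq_mul_inv,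
    ← Real.rpow_neg hz.le]
  have h1 : u ^ (2 * H * k) * u ^ (-(H * (k + 1 : ℕ))) * u ^ (-(H * (k + 1 : ℕ)))
      = u ^ (-(2 * H)) := by
    rw [← Real.rpow_add hu, ← Real.rpow_add hu]
    push_cast
    ring_nf
  have h2 : z ^ (-(H * (k + 1 : ℕ))) = z ^ (-H) * z ^ (-(H * k)) := by
    rw [← Real.rpow_add hz]
    push_cast
    ring_nf
  rw [h2, ← h1]
  ring

theorem abs_fbmCov_integrand_le {H γ u v : ℝ} (k : ℕ) (hH : 1 / 2 < H) (hH1 : H < 1)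
    (hγ : 0 < γ) (hγ1 : γ ≤ 1) (hv : 0 < v) (hvu : v < u) :
    |fbmCov H u v ^ k * u ^ (-(H * (k + 1 : ℕ))) * v ^ (-(H * (k + 1 : ℕ)))| ≤
      Real.exp 1 * (1 - H) ^ (-γ) * ((k : ℝ) + 1) ^ (-γ) *
        (u ^ (-(2 * H)) * betaKernel (H + (1 - H) * γ) (2 * H * γ) (v / u)) := by
  have hu : 0 < u := hv.trans hvu
  obtain ⟨z, rfl⟩ : ∃ z, v = u * z := ⟨v / u, by field_simp⟩
  have hz : 0 < z := pos_of_mul_pos_right hv hu.le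
  have hz1 : z < 1 := by nlinarith
  have h1z : 0 < 1 - z := by linarith
  have h1H : 0 < 1 - H := by linarith
  have hf := fbmCov_one_div_rpow_nonneg (by linarith : 0 < H) hz hz1
  rw [fbmCov_integrand_mul_left k hu hz, abs_of_nonneg (by positivity),
    mul_div_cancel_left₀ _ hu.ne']
  have hb := pow_le_rpow_neg_mul_rpow_neg k hf (by positivity)
    (fbmCov_one_div_rpow_le hH hH1 hz hz1) hγ hγ1
  have hy : ((1 - H) * (z ^ (1 - H) * (1 - z) ^ (2 * H))) ^ (-γ) =
      (1 - H) ^ (-γ) * (z ^ (-((1 - H) * γ)) * (1 - z) ^ (-(2 * H * γ))) := by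
    rw [Real.mul_rpow h1H.le (by positivity), Real.mul_rpow (by positivity) (by positivity),
      ← Real.rpow_mul hz.le, ← Real.rpow_mul h1z.le, mul_neg, mul_neg]
  rw [hy] at hb
  have hz2 : z ^ (-(H + (1 - H) * γ)) = z ^ (-H) * z ^ (-((1 - H) * γ)) := by
    rw [← Real.rpow_add hz]
    ring_nf
  rw [betaKernel, hz2]
  calc _ ≤ u ^ (-(2 * H)) * z ^ (-H) * _ := mul_le_mul_of_nonneg_left hb (by positivity)
    _ = _ := by ring

/-- A function homogeneous of degree `-s` with `s < 2`, supported below the diagonal, that has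
a Beta-type profile is integrable on a square. -/
theorem integrable_betaKernel_div {a b s : ℝ} (ha : a < 1) (hb : b < 1) (hs : s < 2) {T : ℝ}
    (hT : 0 ≤ T) :
    Integrable ({p : ℝ × ℝ | p.2 ≤ p.1}.indicator
        fun p => p.1 ^ (-s) * betaKernel a b (p.2 / p.1))
      ((volume.restrict (Set.Ioc 0 T)).prod (volume.restrict (Set.Ioc 0 T))) := by
  have hmeas : Measurable ({p : ℝ × ℝ | p.2 ≤ p.1}.indicator
      fun p => p.1 ^ (-s) * betaKernel a b (p.2 / p.1)) := by
    refine Measurable.indicator ?_ (measurableSet_le measurable_snd measurable_fst)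
    exact (measurable_fst.pow_const _).mul
      ((measurable_betaKernel a b).comp (measurable_snd.div measurable_fst))
  have hsec (u : ℝ) : (fun v => {p : ℝ × ℝ | p.2 ≤ p.1}.indicator
      (fun p => p.1 ^ (-s) * betaKernel a b (p.2 / p.1)) (u, v)) =
      (Set.Iic u).indicator fun v => u ^ (-s) * betaKernel a b (v / u) := by
    ext v
    simp [Set.indicator_apply]
  have hinter {u : ℝ} (hu : u ∈ Set.Ioc 0 T) : Set.Iic u ∩ Set.Ioc 0 T = Set.Ioc 0 u := by
    ext v
    simp only [Set.mem_inter_iff, Set.mem_Iic, Set.mem_Ioc]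
    constructor
    · tauto
    · exact fun h => ⟨h.2, h.1, h.2.trans hu.2⟩
  rw [integrable_prod_iff hmeas.aestronglyMeasurable]
  constructor
  · filter_upwards [ae_restrict_mem measurableSet_Ioc] with u hu
    rw [hsec, integrable_indicator_iff measurableSet_Iic, IntegrableOn,
      Measure.restrict_restrict measurableSet_Iic, hinter hu]
    have h := (intervalIntegrable_betaKernel ha hb).comp_mul_left (c := u⁻¹)
    simp only [div_inv_eq_mul, zero_mul, one_mul] at h
    rw [intervalIntegrable_iff_integrableOn_Ioc_of_le hu.1.le] at h
    simpa only [div_eq_inv_mul] using h.const_mul (u ^ (-s))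
  · have hpow : IntegrableOn (fun u : ℝ => u ^ (1 - s) * ∫ z in (0 : ℝ)..1, betaKernel a b z)
        (Set.Ioc 0 T) := by
      rw [← intervalIntegrable_iff_integrableOn_Ioc_of_le hT]
      exact (intervalIntegral.intervalIntegrable_rpow' (by linarith)).mul_const _
    refine hpow.congr ?_
    filter_upwards [ae_restrict_mem measurableSet_Ioc] with u hu
    have hnorm (v : ℝ) : ‖{p : ℝ × ℝ | p.2 ≤ p.1}.indicator
        (fun p => p.1 ^ (-s) * betaKernel a b (p.2 / p.1)) (u, v)‖ =
        (Set.Iic u).indicator (fun v => ‖u ^ (-s) * betaKernel a b (v / u)‖) v := by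
      rw [← norm_indicator_eq_indicator_norm, ← hsec]
    simp only [hnorm]
    rw [integral_indicator measurableSet_Iic, Measure.restrict_restrict measurableSet_Iic,
      hinter hu]
    have hcongr : ∫ v in Set.Ioc 0 u, ‖u ^ (-s) * betaKernel a b (v / u)‖ =
        ∫ v in Set.Ioc 0 u, u ^ (-s) * betaKernel a b (v / u) := by
      refine setIntegral_congr_fun measurableSet_Ioc fun v hv => ?_
      have := betaKernel_nonneg (a := a) (b := b) (div_nonneg hv.1.le hu.1.le)
        (div_le_one_of_le₀ hv.2 hu.1.le)
      have := Real.rpow_nonneg hu.1.le (-s)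
      exact Real.norm_of_nonneg (by positivity)
    rw [hcongr, ← intervalIntegral.integral_of_le hu.1.le, intervalIntegral.integral_const_mul,
      intervalIntegral.integral_comp_div _ hu.1.ne', zero_div, div_self hu.1.ne', smul_eq_mul,
      ← mul_assoc, ← Real.rpow_add_one hu.1.ne']
    ring_nf

/-- A double integral is bounded by the integral of a dominating function on the product. -/
theorem abs_integral_integral_le {f : ℝ → ℝ → ℝ} {g : ℝ × ℝ → ℝ} {μ ν : Measure ℝ} [SFinite μ]
    [SFinite ν] (hg : Integrable g (μ.prod ν))
    (h : ∀ᵐ u ∂μ, ∀ᵐ v ∂ν, |f u v| ≤ g (u, v)) :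
    |∫ u, ∫ v, f u v ∂ν ∂μ| ≤ ∫ p, g p ∂(μ.prod ν) := by
  rw [integral_prod g hg, ← Real.norm_eq_abs]
  refine norm_integral_le_of_norm_le hg.integral_prod_left ?_
  filter_upwards [h, hg.prod_right_ae] with u hu hgu
  exact norm_integral_le_of_norm_le hgu hu

theorem exists_abs_fbmCov_integral_le {H γ T : ℝ} (hH : 1 / 2 < H) (hH1 : H < 1)
    (hγ : 0 < γ) (hγH : γ < 1 / (2 * H)) (hT : 0 < T) :
    ∃ C : ℝ, ∀ k : ℕ, |∫ u in (0 : ℝ)..T, ∫ v in (0 : ℝ)..T,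
      fbmCov H u v ^ k * u ^ (-(H * (k + 1 : ℕ))) * v ^ (-(H * (k + 1 : ℕ)))| ≤
        C * ((k : ℝ) + 1) ^ (-γ) := by
  have hb : 2 * H * γ < 1 := by
    rw [lt_div_iff₀ (by linarith)] at hγH
    linarith
  have hγ1 : γ < 1 := by nlinarith
  have ha : H + (1 - H) * γ < 1 := by nlinarith
  have hg₁ := integrable_betaKernel_div ha hb (by linarith : 2 * H < 2) hT.le
  set μ := volume.restrict (Set.Ioc 0 T)
  set g := {p : ℝ × ℝ | p.2 ≤ p.1}.indicator
    fun p => p.1 ^ (-(2 * H)) * betaKernel (H + (1 - H) * γ) (2 * H * γ) (p.2 / p.1) with hgdef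
  set K := Real.exp 1 * (1 - H) ^ (-γ)
  have hg : Integrable (fun p => g p + g p.swap) (μ.prod μ) := hg₁.add hg₁.swap
  have hg_nonneg {p : ℝ × ℝ} (h1 : 0 < p.1) (h2 : 0 < p.2) : 0 ≤ g p := by
    refine Set.indicator_apply_nonneg fun hp => ?_
    have := betaKernel_nonneg (a := H + (1 - H) * γ) (b := 2 * H * γ)
      (div_nonneg h2.le h1.le) (div_le_one_of_le₀ hp h1.le)
    positivity
  have hg_le {u v : ℝ} (k : ℕ) (hv : 0 < v) (hvu : v < u) :
      |fbmCov H u v ^ k * u ^ (-(H * (k + 1 : ℕ))) * v ^ (-(H * (k + 1 : ℕ)))| ≤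
        K * ((k : ℝ) + 1) ^ (-γ) * g (u, v) := by
    rw [hgdef, Set.indicator_of_mem (show (u, v) ∈ {p : ℝ × ℝ | p.2 ≤ p.1} from hvu.le)]
    exact abs_fbmCov_integrand_le k hH hH1 hγ hγ1.le hv hvu
  have hK : 0 ≤ K := by
    have : 0 ≤ 1 - H := by linarith
    positivity
  refine ⟨K * ∫ p, g p + g p.swap ∂(μ.prod μ), fun k => ?_⟩
  have hKk : 0 ≤ K * ((k : ℝ) + 1) ^ (-γ) := by positivity
  simp only [intervalIntegral.integral_of_le hT.le]
  refine (abs_integral_integral_le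
    (hg.const_mul (K * ((k : ℝ) + 1) ^ (-γ))) ?_).trans_eq ?_
  · filter_upwards [ae_restrict_mem measurableSet_Ioc] with u hu
    filter_upwards [ae_restrict_mem measurableSet_Ioc,
      ae_restrict_of_ae (Measure.ae_ne volume u)] with v hv hne
    have h₁ := hg_nonneg (p := (u, v)) hu.1 hv.1
    have h₂ := hg_nonneg (p := (v, u)) hv.1 hu.1
    simp only [Prod.swap_prod_mk]
    rcases hne.lt_or_gt with h | h
    · refine (hg_le k hv.1 h).trans (mul_le_mul_of_nonneg_left (by linarith) hKk)
    · rw [fbmCov_comm, mul_right_comm]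
      exact (hg_le k hu.1 h).trans (mul_le_mul_of_nonneg_left (by linarith) hKk)
  · rw [integral_const_mul]
    ring

theorem Gamma_add_half_sq_le {x : ℝ} (hx : 0 < x) :
    Real.Gamma (x + 1 / 2) ^ 2 * x ≤ Real.Gamma (x + 1) ^ 2 := by
  have h := Real.Gamma_mul_add_mul_le_rpow_Gamma_mul_rpow_Gamma hx (by linarith : 0 < x + 1)
    (one_half_pos (α := ℝ)) one_half_pos (by norm_num)
  have hG := Real.Gamma_pos_of_pos hx
  have hG1 := Real.Gamma_pos_of_pos (by linarith : 0 < x + 1)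
  rw [← Real.sqrt_eq_rpow, ← Real.sqrt_eq_rpow, ← Real.sqrt_mul hG.le,
    show 1 / 2 * x + 1 / 2 * (x + 1) = x + 1 / 2 by ring] at h
  have h2 := pow_le_pow_left₀ (Real.Gamma_pos_of_pos (by linarith)).le h 2
  rw [Real.sq_sqrt (by positivity)] at h2
  calc _ ≤ Real.Gamma x * Real.Gamma (x + 1) * x := by gcongr
    _ = _ := by rw [Real.Gamma_add_one hx.ne']; ring

theorem mul_factorial_mul_hermiteBound_sq_le {n : ℕ} (hn : 0 < n) :
    (n : ℝ) * n.factorial * hermiteBound n ^ 2 ≤ (n : ℝ) ^ (1 / 2 : ℝ) := by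
  have hn' : (0 : ℝ) < n := by exact_mod_cast hn
  set A := Real.Gamma ((n : ℝ) / 2 + 1 / 2) with hA
  set B := Real.Gamma ((n : ℝ) / 2 + 1) with hB
  have hApos : 0 < A := Real.Gamma_pos_of_pos (by positivity)
  have hBpos : 0 < B := Real.Gamma_pos_of_pos (by positivity)
  have hfac : (0 : ℝ) < n.factorial := by exact_mod_cast n.factorial_pos
  have hsqrt : 0 < √π := Real.sqrt_pos.2 Real.pi_pos
  have hAB : A * B * 2 ^ n = n.factorial * √π := by
    have h := Real.Gamma_mul_Gamma_add_half ((n : ℝ) / 2 + 1 / 2)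
    rw [show (n : ℝ) / 2 + 1 / 2 + 1 / 2 = n / 2 + 1 by ring,
      show 2 * ((n : ℝ) / 2 + 1 / 2) = n + 1 by ring, Real.Gamma_nat_eq_factorial,
      show (1 : ℝ) - (n + 1) = -n by ring, Real.rpow_neg zero_le_two, Real.rpow_natCast] at h
    rw [h]
    field_simp
  have hsq : A ^ 2 * (n / 2) ≤ B ^ 2 := Gamma_add_half_sq_le (by positivity)
  have hherm : hermiteBound n ^ 2 = 2 ^ n * A ^ 2 / (π * n.factorial ^ 2) := by
    rw [hermiteBound, div_pow, mul_pow, mul_pow, ← Real.rpow_mul_natCast zero_le_two,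
      Real.sq_sqrt Real.pi_pos.le, hA, add_div]
    rw [show (n : ℝ) / 2 * (2 : ℕ) = n by push_cast; ring, Real.rpow_natCast]
  have hval : (n : ℝ) * n.factorial * hermiteBound n ^ 2 = n * (A / (√π * B)) := by
    rw [hherm]
    have hpi : π = √π * √π := (Real.mul_self_sqrt Real.pi_pos.le).symm
    rw [show (2 : ℝ) ^ n * A ^ 2 / (π * n.factorial ^ 2) =
      A * (A * B * 2 ^ n) / (B * π * n.factorial ^ 2) by field_simp, hAB, hpi]
    rw [Real.sqrt_mul_self hsqrt.le]
    field_simp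
  rw [hval, ← Real.sqrt_eq_rpow]
  apply Real.le_sqrt_of_sq_le
  rw [mul_pow, div_pow, mul_pow, Real.sq_sqrt Real.pi_pos.le, ← mul_div_assoc,
    div_le_iff₀ (by positivity)]
  have hpi := Real.pi_gt_three
  nlinarith [mul_le_mul_of_nonneg_left hsq hn'.le, mul_pos hn' (pow_pos hBpos 2)]

theorem summable_nat_add_rpow {p : ℝ} (hp : p < -1) (m : ℕ) :
    Summable fun k : ℕ => ((k : ℝ) + m) ^ p := by
  simpa using (summable_nat_add_iff m).2 (Real.summable_nat_rpow.2 hp)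

/-- for `H ∈ (1/2,1)`, `T > 0` and `α < 1/(2H) − 3/2`, the series
`∑_{n=1}^∞ (n+2)^α · n · n! · c_n² · ∫_0^T ∫_0^T R(u,v)^{n−1} u^{−Hn} v^{−Hn} du dv`
converges.  (The index below is shifted: `k` corresponds to `n = k+1`.) -/
theorem fbm_current_watanabe_offdiagonal_summable
    (H T α : ℝ) (hH : 1 / 2 < H) (hH1 : H < 1) (hT : 0 < T)
    (hα : α < 1 / (2 * H) - 3 / 2) :
    Summable (fun k : ℕ =>
      ((k : ℝ) + 1 + 2) ^ α * ((k : ℝ) + 1) * ((k + 1).factorial : ℝ) *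
        (hermiteBound (k + 1)) ^ 2 *
        ∫ u in (0 : ℝ)..T, ∫ v in (0 : ℝ)..T,
          (fbmCov H u v) ^ k * u ^ (-(H * (k + 1 : ℕ))) * v ^ (-(H * (k + 1 : ℕ)))) := by
  obtain ⟨γ, hγ, hγH⟩ : ∃ γ, max 0 (α + 3 / 2) < γ ∧ γ < 1 / (2 * H) := by
    apply exists_between
    rw [max_lt_iff]
    exact ⟨by positivity, by linarith⟩
  rw [max_lt_iff] at hγ
  obtain ⟨C, hC⟩ := exists_abs_fbmCov_integral_le hH hH1 hγ.1 hγH hT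
  have hC0 : 0 ≤ C := by simpa using (abs_nonneg _).trans (hC 0)
  refine Summable.of_norm_bounded ((summable_nat_add_rpow
    (by linarith : α + 1 / 2 + -γ < -1) 3).mul_left (C * 3 ^ γ)) fun k => ?_
  have hk : (0 : ℝ) < k + 3 := by positivity
  have hcoef := mul_factorial_mul_hermiteBound_sq_le k.succ_pos
  rw [Nat.succ_eq_add_one, Nat.cast_add_one] at hcoef
  have hhalf : ((k : ℝ) + 1) ^ (1 / 2 : ℝ) ≤ ((k : ℝ) + 3) ^ (1 / 2 : ℝ) := by
    gcongr
    norm_num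
  have hdecay : ((k : ℝ) + 1) ^ (-γ) ≤ 3 ^ γ * ((k : ℝ) + 3) ^ (-γ) := by
    have h : ((k : ℝ) + 3) / 3 ≤ k + 1 := by linarith [(Nat.cast_nonneg k : (0 : ℝ) ≤ k)]
    calc ((k : ℝ) + 1) ^ (-γ) ≤ (((k : ℝ) + 3) / 3) ^ (-γ) :=
          Real.rpow_le_rpow_of_nonpos (by positivity) h (by linarith)
      _ = _ := by
          rw [Real.div_rpow hk.le (by norm_num), Real.rpow_neg (by norm_num : (0 : ℝ) ≤ 3),
            div_inv_eq_mul, mul_comm]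
  rw [Real.norm_eq_abs, abs_mul, abs_of_nonneg (by positivity), add_assoc (k : ℝ) 1 2,
    show (1 : ℝ) + 2 = 3 by norm_num, mul_assoc (_ ^ α), mul_assoc (_ ^ α)]
  calc _ ≤ ((k : ℝ) + 3) ^ α * ((k : ℝ) + 3) ^ (1 / 2 : ℝ) *
        (C * (3 ^ γ * ((k : ℝ) + 3) ^ (-γ))) := by
        gcongr
        · exact hcoef.trans hhalf
        · exact (hC k).trans (by gcongr)
    _ = C * 3 ^ γ * ((k : ℝ) + (3 : ℕ)) ^ (α + 1 / 2 + -γ) := by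
        rw [Nat.cast_ofNat, Real.rpow_add hk, Real.rpow_add hk]
        ring
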